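/- In the Jin–Xin split scheme setup, let (u^n, v^n) be the iterates obtained by applying the one-step map n times to initial data (u^0, v^0), and define the first-difference operator (Dw)_i = w_{i+1} − w_i on the periodic grid. Then the energy of first differences is non-increasing: for every n, Σ_i [ (a−b²)·((Du^n)_i)² + ( b·(Du^n)_i − (Dv^n)_i )² ]·Δx ≤ Σ_i [ (a−b²)·((Du^0)_i)² + ( b·(Du^0)_i − (Dv^0)_i )² ]·Δx. -/

import Mathlib

/-- Convection step of the Jin–Xin split scheme on the periodic grid `ZMod X`,
in characteristic variables `ρ = √a·u + v`, `l = √a·u − v`: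
`ρ*_i = (1−ν)ρ_i + νρ_{i−1}`, `l*_i = (1−ν)l_i + νl_{i+1}`,
`u* = (ρ* + l*)/(2√a)`, `v* = (ρ* − l*)/2`. -/
noncomputable def jxConv {X : ℕ} (a ν : ℝ) (w : (ZMod X → ℝ) × (ZMod X → ℝ)) :
    (ZMod X → ℝ) × (ZMod X → ℝ) :=
  let ρ : ZMod X → ℝ := fun i => Real.sqrt a * w.1 i + w.2 i
  let l : ZMod X → ℝ := fun i => Real.sqrt a * w.1 i - w.2 i
  let ρs : ZMod X → ℝ := fun i => (1 - ν) * ρ i + ν * ρ (i - 1)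
  let ls : ZMod X → ℝ := fun i => (1 - ν) * l i + ν * l (i + 1)
  (fun i => (ρs i + ls i) / (2 * Real.sqrt a), fun i => (ρs i - ls i) / 2)

/-- One full step of the deterministic Jin–Xin split scheme: convection step followed
by the relaxation step `u' = u*`, `v' = p·v* + (1−p)·b·u*`. -/
noncomputable def jxStep {X : ℕ} (a b ν p : ℝ) (w : (ZMod X → ℝ) × (ZMod X → ℝ)) :
    (ZMod X → ℝ) × (ZMod X → ℝ) :=
  let ws := jxConv a ν w
  (ws.1, fun i => p * ws.2 i + (1 - p) * (b * ws.1 i))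

/-- Discrete energy `E(u,v) = ∑_i [(a−b²)u_i² + (b·u_i − v_i)²]·Δx`. -/
noncomputable def jxEnergy {X : ℕ} [NeZero X] (a b Δx : ℝ)
    (w : (ZMod X → ℝ) × (ZMod X → ℝ)) : ℝ :=
  ∑ i : ZMod X, ((a - b ^ 2) * (w.1 i) ^ 2 + (b * w.1 i - w.2 i) ^ 2) * Δx

/-- The forward difference `(Dw)_i = w_{i+1} − w_i`, applied to both components. -/
def jxDiff {X : ℕ} (w : (ZMod X → ℝ) × (ZMod X → ℝ)) : (ZMod X → ℝ) × (ZMod X → ℝ) :=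
  (fun i => w.1 (i + 1) - w.1 i, fun i => w.2 (i + 1) - w.2 i)

theorem jxDiff_semiconj_jxStep {X : ℕ} (a b ν p : ℝ) :
    Function.Semiconj (jxDiff (X := X)) (jxStep a b ν p) (jxStep a b ν p) := by
  intro w
  ext i <;> simp only [jxDiff, jxStep, jxConv, add_sub_cancel_right, sub_add_cancel] <;> ring

/-- In characteristic variables the energy density is diagonal. -/
theorem jx_energy_density_eq {a : ℝ} (ha : 0 < a) (b u v : ℝ) :
    (a - b ^ 2) * u ^ 2 + (b * u - v) ^ 2 =
      (√a - b) / (2 * √a) * (√a * u + v) ^ 2 + (√a + b) / (2 * √a) * (√a * u - v) ^ 2 := by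
  have hs : √a ≠ 0 := (Real.sqrt_pos.2 ha).ne'
  have h : a = √a ^ 2 := (Real.sq_sqrt ha.le).symm
  rw [show (a - b ^ 2) = √a ^ 2 - b ^ 2 by rw [← h]]
  field_simp
  ring

theorem sq_convex_comb_le {ν : ℝ} (h0 : 0 ≤ ν) (h1 : ν ≤ 1) (x y : ℝ) :
    ((1 - ν) * x + ν * y) ^ 2 ≤ (1 - ν) * x ^ 2 + ν * y ^ 2 := by
  nlinarith [mul_nonneg (mul_nonneg h0 (sub_nonneg.2 h1)) (sq_nonneg (x - y))]

/-- Averaging with a shifted copy does not increase the sum of squares on a periodic grid. -/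
theorem sum_sq_convex_shift_le {X : ℕ} [NeZero X] {ν : ℝ} (h0 : 0 ≤ ν) (h1 : ν ≤ 1)
    (f : ZMod X → ℝ) (c : ZMod X) :
    ∑ i, ((1 - ν) * f i + ν * f (i + c)) ^ 2 ≤ ∑ i, f i ^ 2 := by
  calc ∑ i, ((1 - ν) * f i + ν * f (i + c)) ^ 2
      ≤ ∑ i, ((1 - ν) * f i ^ 2 + ν * f (i + c) ^ 2) :=
        Finset.sum_le_sum fun i _ => sq_convex_comb_le h0 h1 _ _
    _ = ∑ i, f i ^ 2 := by
        have h : ∑ i, f (i + c) ^ 2 = ∑ i, f i ^ 2 :=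
          Equiv.sum_comp (Equiv.addRight c) fun i => f i ^ 2
        rw [Finset.sum_add_distrib, ← Finset.mul_sum, ← Finset.mul_sum, h]
        ring

theorem jxEnergy_eq {X : ℕ} [NeZero X] {a : ℝ} (ha : 0 < a) (b Δx : ℝ)
    (w : (ZMod X → ℝ) × (ZMod X → ℝ)) :
    jxEnergy a b Δx w =
      ((√a - b) / (2 * √a) * ∑ i, (√a * w.1 i + w.2 i) ^ 2 +
        (√a + b) / (2 * √a) * ∑ i, (√a * w.1 i - w.2 i) ^ 2) * Δx := by
  simp only [jxEnergy, jx_energy_density_eq ha, ← Finset.sum_mul, Finset.sum_add_distrib,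
    ← Finset.mul_sum]

theorem jxEnergy_jxConv_le {X : ℕ} [NeZero X] {a b ν Δx : ℝ} (hΔx : 0 ≤ Δx) (ha : 0 < a)
    (hab : b ^ 2 ≤ a) (h0 : 0 ≤ ν) (h1 : ν ≤ 1) (w : (ZMod X → ℝ) × (ZMod X → ℝ)) :
    jxEnergy a b Δx (jxConv a ν w) ≤ jxEnergy a b Δx w := by
  have hs : 0 < √a := Real.sqrt_pos.2 ha
  obtain ⟨hb, hb'⟩ := abs_le.1 (Real.abs_le_sqrt hab)
  have hρ : 0 ≤ (√a - b) / (2 * √a) := div_nonneg (by linarith) (by positivity)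
  have hl : 0 ≤ (√a + b) / (2 * √a) := div_nonneg (by linarith) (by positivity)
  have hconv_add (i : ZMod X) : √a * (jxConv a ν w).1 i + (jxConv a ν w).2 i =
      (1 - ν) * (√a * w.1 i + w.2 i) + ν * (√a * w.1 (i + -1) + w.2 (i + -1)) := by
    simp only [jxConv, ← sub_eq_add_neg]
    field_simp
    ring
  have hconv_sub (i : ZMod X) : √a * (jxConv a ν w).1 i - (jxConv a ν w).2 i =
      (1 - ν) * (√a * w.1 i - w.2 i) + ν * (√a * w.1 (i + 1) - w.2 (i + 1)) := by
    simp only [jxConv]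
    field_simp
    ring
  simp only [jxEnergy_eq ha, hconv_add, hconv_sub]
  exact mul_le_mul_of_nonneg_right (add_le_add
    (mul_le_mul_of_nonneg_left
      (sum_sq_convex_shift_le h0 h1 (fun i => √a * w.1 i + w.2 i) (-1)) hρ)
    (mul_le_mul_of_nonneg_left
      (sum_sq_convex_shift_le h0 h1 (fun i => √a * w.1 i - w.2 i) 1) hl)) hΔx

theorem jxEnergy_jxStep_le_jxConv {X : ℕ} [NeZero X] {a b ν p Δx : ℝ} (hΔx : 0 ≤ Δx)
    (hp0 : 0 ≤ p) (hp1 : p ≤ 1) (w : (ZMod X → ℝ) × (ZMod X → ℝ)) :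
    jxEnergy a b Δx (jxStep a b ν p w) ≤ jxEnergy a b Δx (jxConv a ν w) := by
  refine Finset.sum_le_sum fun i _ => mul_le_mul_of_nonneg_right ?_ hΔx
  refine add_le_add le_rfl ?_
  have h : b * (jxStep a b ν p w).1 i - (jxStep a b ν p w).2 i =
      p * (b * (jxConv a ν w).1 i - (jxConv a ν w).2 i) := by
    simp only [jxStep]
    ring
  rw [h, mul_pow]
  exact mul_le_of_le_one_left (sq_nonneg _) (pow_le_one₀ hp0 hp1)

theorem jxEnergy_iterate_le {X : ℕ} [NeZero X] {a b ν p Δx : ℝ} (hΔx : 0 ≤ Δx) (ha : 0 < a)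
    (hab : b ^ 2 ≤ a) (h0 : 0 ≤ ν) (h1 : ν ≤ 1) (hp0 : 0 ≤ p) (hp1 : p ≤ 1)
    (w : (ZMod X → ℝ) × (ZMod X → ℝ)) (n : ℕ) :
    jxEnergy a b Δx ((jxStep a b ν p)^[n] w) ≤ jxEnergy a b Δx w := by
  induction n with
  | zero => exact le_rfl
  | succ n ih =>
    rw [Function.iterate_succ_apply']
    exact ((jxEnergy_jxStep_le_jxConv hΔx hp0 hp1 _).trans
      (jxEnergy_jxConv_le hΔx ha hab h0 h1 _)).trans ih

/-- **Energy decay of first differences for the deterministic Jin–Xin split scheme**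
(the estimate behind `rem:square-variation`): with `(Dw)_i = w_{i+1} − w_i` on the
periodic grid, the first-difference energy of the iterates never exceeds that of the
initial data. -/
theorem jx_difference_energy_decay (X : ℕ) [NeZero X] (Δx : ℝ) (hΔx : 0 < Δx)
    (a b ν p : ℝ) (ha : 0 < a) (hab : b ^ 2 ≤ a)
    (hν : ν ∈ Set.Ioc (0 : ℝ) 1) (hp : p ∈ Set.Ico (0 : ℝ) 1)
    (u0 v0 : ZMod X → ℝ) (n : ℕ) :
    (∑ i : ZMod X,
        ((a - b ^ 2) * (((jxStep a b ν p)^[n] (u0, v0)).1 (i + 1) -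
            ((jxStep a b ν p)^[n] (u0, v0)).1 i) ^ 2 +
          (b * (((jxStep a b ν p)^[n] (u0, v0)).1 (i + 1) -
              ((jxStep a b ν p)^[n] (u0, v0)).1 i) -
            (((jxStep a b ν p)^[n] (u0, v0)).2 (i + 1) -
              ((jxStep a b ν p)^[n] (u0, v0)).2 i)) ^ 2) * Δx) ≤
      ∑ i : ZMod X,
        ((a - b ^ 2) * (u0 (i + 1) - u0 i) ^ 2 +
          (b * (u0 (i + 1) - u0 i) - (v0 (i + 1) - v0 i)) ^ 2) * Δx := by
  have h := jxEnergy_iterate_le hΔx.le ha hab hν.1.le hν.2 hp.1 hp.2.le (jxDiff (u0, v0)) n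
  rw [← (jxDiff_semiconj_jxStep a b ν p).iterate_right n (u0, v0)] at h
  exact h
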